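/- arXiv:1702.03873 — 9 statements merged into one kernel-verified Lean document; each statement's English description precedes it below -/
import Mathlib

section
/- If λ ∈ ℝ is an eigenvalue of B (i.e. B·v = λ·v for some nonzero v ∈ ℝ^N), then 2·(min over i ∈ Fin N of B i i) ≤ λ ≤ 0. -/
open Matrix

/-- Matrix representation of the μ-derivative ∇^μ for the discrete measure
μ = Σᵢ αᵢ δ_{zᵢ}: `A i i = -(α i)⁻¹`, `A i (i+1 mod N) = (α i)⁻¹`, all other entries `0`. -/
noncomputable def matA (N : ℕ) [NeZero N] (α : Fin N → ℝ) : Matrix (Fin N) (Fin N) ℝ :=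
  Matrix.of fun i j => if j = i then -(α i)⁻¹ else if j = i + 1 then (α i)⁻¹ else 0

/-- Matrix representation of the μ-Laplacian Δ^μ: `B = -Aᵀ·A`. -/
noncomputable def matB (N : ℕ) [NeZero N] (α : Fin N → ℝ) : Matrix (Fin N) (Fin N) ℝ :=
  -((matA N α)ᵀ * matA N α)

theorem Fin.add_one_ne_self {N : ℕ} [NeZero N] (hN : 2 ≤ N) (k : Fin N) : k + 1 ≠ k := by
  obtain ⟨n, rfl⟩ := Nat.exists_eq_add_of_le' hN
  simp

theorem sum_comp_matA {N : ℕ} [NeZero N] (hN : 2 ≤ N) (α : Fin N → ℝ) (k : Fin N)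
    (f : Fin N → ℝ → ℝ) (hf : ∀ j, f j 0 = 0) :
    ∑ j, f j (matA N α k j) = f k (-(α k)⁻¹) + f (k + 1) (α k)⁻¹ := by
  have hk := Fin.add_one_ne_self hN k
  rw [← Finset.sum_subset (Finset.subset_univ {k, k + 1}), Finset.sum_pair hk.symm]
  · simp [matA, hk]
  · intro j _ hj
    simp only [Finset.mem_insert, Finset.mem_singleton, not_or] at hj
    simp [matA, hj.1, hj.2, hf]

theorem matA_mulVec_sq_le {N : ℕ} [NeZero N] (hN : 2 ≤ N) (α v : Fin N → ℝ) (k : Fin N) :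
    (matA N α *ᵥ v) k ^ 2 ≤ 2 * ∑ j, matA N α k j ^ 2 * v j ^ 2 := by
  have h₁ : (matA N α *ᵥ v) k = -(α k)⁻¹ * v k + (α k)⁻¹ * v (k + 1) :=
    sum_comp_matA hN α k (fun j x => x * v j) (by simp)
  have h₂ := sum_comp_matA hN α k (fun j x => x ^ 2 * v j ^ 2) (by simp)
  rw [h₁, h₂]
  simp only [← mul_pow]
  exact add_sq_le

theorem matB_diag (N : ℕ) [NeZero N] (α : Fin N → ℝ) (i : Fin N) :
    matB N α i i = -∑ k, matA N α k i ^ 2 := by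
  simp [matB, Matrix.mul_apply, sq]

theorem dotProduct_matB_mulVec (N : ℕ) [NeZero N] (α v : Fin N → ℝ) :
    v ⬝ᵥ (matB N α *ᵥ v) = -∑ k, (matA N α *ᵥ v) k ^ 2 := by
  rw [matB, Matrix.neg_mulVec, dotProduct_neg, ← Matrix.mulVec_mulVec, Matrix.dotProduct_mulVec,
    Matrix.vecMul_transpose]
  simp [dotProduct, sq]

theorem sum_matA_mulVec_sq_le {N : ℕ} [NeZero N] (hN : 2 ≤ N) (α v : Fin N → ℝ) :
    ∑ k, (matA N α *ᵥ v) k ^ 2 ≤ -(2 * ⨅ i, matB N α i i) * (v ⬝ᵥ v) := by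
  calc ∑ k, (matA N α *ᵥ v) k ^ 2
      ≤ ∑ k, 2 * ∑ j, matA N α k j ^ 2 * v j ^ 2 :=
        Finset.sum_le_sum fun k _ => matA_mulVec_sq_le hN α v k
    _ = ∑ j, 2 * (-matB N α j j * v j ^ 2) := by
        simp only [← Finset.mul_sum, matB_diag, neg_neg, Finset.sum_mul]
        rw [Finset.sum_comm]
    _ ≤ ∑ j, 2 * (-(⨅ i, matB N α i i) * v j ^ 2) := by
        gcongr with j
        exact ciInf_le (Set.finite_range _).bddBelow j
    _ = -(2 * ⨅ i, matB N α i i) * (v ⬝ᵥ v) := by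
        simp only [← Finset.mul_sum, dotProduct, sq]
        ring

/-- If λ is an eigenvalue of B, then 2·(minᵢ B i i) ≤ λ ≤ 0. -/
theorem matB_eigenvalue_bounds (N : ℕ) [NeZero N] (hN : 2 ≤ N) (α : Fin N → ℝ)
    (hα : ∀ i, 0 < α i) (lam : ℝ) (v : Fin N → ℝ) (hv : v ≠ 0)
    (h : (matB N α).mulVec v = lam • v) :
    2 * (⨅ i, matB N α i i) ≤ lam ∧ lam ≤ 0 := by
  have hpos : 0 < v ⬝ᵥ v := by simpa using Matrix.dotProduct_star_self_pos_iff.mpr hv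
  have hquad := dotProduct_matB_mulVec N α v
  rw [h, dotProduct_smul, smul_eq_mul] at hquad
  have hle := sum_matA_mulVec_sq_le hN α v
  have hnonneg : 0 ≤ ∑ k, (matA N α *ᵥ v) k ^ 2 := Finset.sum_nonneg fun k _ => sq_nonneg _
  constructor
  · exact le_of_mul_le_mul_right (by linarith) hpos
  · exact nonpos_of_mul_nonpos_left (by linarith) hpos
end

section
/- The eigenvalue 0 of B is simple: the kernel of B (as a linear map ℝ^N → ℝ^N) is exactly the span of the all-ones vector, i.e. B·v = 0 if and only if v is a constant vector. -/
open Matrix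

/-- The matrix `matA` acts as the weighted cyclic difference operator. -/
theorem matA_mulVec_apply {N : ℕ} [NeZero N] (hN : 2 ≤ N) (α v : Fin N → ℝ) (i : Fin N) :
    (matA N α *ᵥ v) i = (α i)⁻¹ * (v (i + 1) - v i) := by
  have hne : i + 1 ≠ i := by simp [show N ≠ 1 by lia]
  have hentry (j : Fin N) : matA N α i j * v j =
      (if j = i then -(α i)⁻¹ * v j else 0) + (if j = i + 1 then (α i)⁻¹ * v j else 0) := by
    rw [matA, Matrix.of_apply]
    by_cases hj : j = i
    · simp [hj, hne.symm]
    · simp [hj]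
  simp only [Matrix.mulVec, dotProduct, hentry, Finset.sum_add_distrib, Finset.sum_ite_eq',
    Finset.mem_univ, if_true]
  ring

/-- A function on `Fin N` invariant under the cyclic shift is constant. -/
theorem Fin.eq_apply_zero_of_apply_add_one {β : Type*} {N : ℕ} [NeZero N] {v : Fin N → β}
    (h : ∀ i, v (i + 1) = v i) (i : Fin N) : v i = v 0 := by
  have hcast (k : ℕ) : v (Fin.ofNat N k) = v 0 := by
    induction k with
    | zero => rfl
    | succ k ih =>
      rw [← ih, ← h (Fin.ofNat N k)]
      congr 1
      ext
      simp [Fin.val_add]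
  simpa using hcast i

/-- The eigenvalue 0 of B is simple: B·v = 0 if and only if v is a constant vector. -/
theorem matB_kernel_eq_constants (N : ℕ) [NeZero N] (hN : 2 ≤ N) (α : Fin N → ℝ)
    (hα : ∀ i, 0 < α i) (v : Fin N → ℝ) :
    (matB N α).mulVec v = 0 ↔ ∃ c : ℝ, v = fun _ => c := by
  have hker : matB N α *ᵥ v = 0 ↔ matA N α *ᵥ v = 0 := by
    rw [matB, Matrix.neg_mulVec, neg_eq_zero, ← Matrix.conjTranspose_eq_transpose_of_trivial,
      Matrix.conjTranspose_mul_self_mulVec_eq_zero]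
  rw [hker]
  constructor
  · intro h
    refine ⟨v 0, funext (Fin.eq_apply_zero_of_apply_add_one fun i => ?_)⟩
    have hi := congrFun h i
    rw [matA_mulVec_apply hN, Pi.zero_apply, mul_eq_zero, sub_eq_zero] at hi
    exact hi.resolve_left (inv_ne_zero (hα i).ne')
  · rintro ⟨c, rfl⟩
    ext i
    simp [matA_mulVec_apply hN]
end

section
/- The matrix A² = A·A is symmetric if and only if N = 2 and α 0 = α 1. -/
open Matrix

theorem matA_mul_apply {N : ℕ} [NeZero N] (α : Fin N → ℝ) (M : Matrix (Fin N) (Fin N) ℝ)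
    {i : Fin N} (hi : i + 1 ≠ i) (j : Fin N) :
    (matA N α * M) i j = (α i)⁻¹ * (M (i + 1) j - M i j) := by
  have h : ∀ k, matA N α i k * M k j =
      (if k = i then -(α i)⁻¹ * M k j else 0) + (if k = i + 1 then (α i)⁻¹ * M k j else 0) := by
    intro k
    by_cases h₁ : k = i
    · subst h₁
      simp [matA, hi.symm]
    · by_cases h₂ : k = i + 1 <;> simp [matA, h₁, h₂, hi]
  simp only [Matrix.mul_apply, h, Finset.sum_add_distrib, Finset.sum_ite_eq', Finset.mem_univ,
    if_true]
  ring

/-- A² is symmetric if and only if N = 2 and α 0 = α 1. -/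
theorem matA_sq_symmetric_iff (N : ℕ) [NeZero N] (hN : 2 ≤ N) (α : Fin N → ℝ)
    (hα : ∀ i, 0 < α i) :
    (matA N α * matA N α)ᵀ = matA N α * matA N α ↔ N = 2 ∧ α 0 = α 1 := by
  have h₁₀ : (1 : Fin N) ≠ 0 := by
    simp [Fin.ext_iff, Nat.mod_eq_of_lt hN]
  have hpos : ∀ i, 0 < (α i)⁻¹ := fun i => inv_pos.mpr (hα i)
  rcases hN.eq_or_lt with rfl | hN'
  · have h₂ : (1 + 1 : Fin 2) = 0 := rfl
    have e₀₁ : (matA 2 α * matA 2 α) 0 1 = -((α 0)⁻¹ * ((α 0)⁻¹ + (α 1)⁻¹)) := by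
      rw [matA_mul_apply α _ (by simp)]
      simp [matA]
      ring
    have e₁₀ : (matA 2 α * matA 2 α) 1 0 = -((α 1)⁻¹ * ((α 0)⁻¹ + (α 1)⁻¹)) := by
      rw [matA_mul_apply α _ (by simp [h₂]), h₂]
      simp [matA, h₂]
      ring
    constructor
    · intro h
      have h' := congrFun (congrFun h 0) 1
      rw [Matrix.transpose_apply, e₀₁, e₁₀, neg_inj] at h'
      exact ⟨rfl, (inv_injective (mul_right_cancel₀ (add_pos (hpos 0) (hpos 1)).ne' h')).symm⟩
    · rintro ⟨-, h⟩
      have e : (matA 2 α * matA 2 α) 1 0 = (matA 2 α * matA 2 α) 0 1 := by rw [e₁₀, e₀₁, h]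
      ext i j
      rw [Matrix.transpose_apply]
      fin_cases i <;> fin_cases j
      · rfl
      · exact e
      · exact e.symm
      · rfl
  · have h₂₀ : (1 + 1 : Fin N) ≠ 0 := by
      simp [Fin.ext_iff, Fin.val_add, Nat.mod_eq_of_lt hN']
    refine iff_of_false (fun h => ?_) (fun h => hN'.ne' h.1)
    have h' := congrFun (congrFun h 0) 1
    rw [Matrix.transpose_apply, matA_mul_apply α _ (by simpa using h₁₀),
      matA_mul_apply α _ (by simpa using h₁₀)] at h'
    have e₁ : matA N α 1 0 = 0 := by simp [matA, h₁₀.symm, h₂₀.symm]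
    have e₂ : 0 ≤ matA N α (1 + 1) 0 := by
      simp only [matA, Matrix.of_apply, h₂₀.symm, if_false]
      split_ifs
      exacts [(hpos _).le, le_rfl]
    have e₃ : matA N α (0 + 1) 1 = -(α 1)⁻¹ := by simp [matA]
    have e₄ : matA N α 0 1 = (α 0)⁻¹ := by simp [matA, h₁₀]
    rw [e₁, e₃, e₄] at h'
    have hl := mul_nonneg (hpos 1).le e₂
    have hr := mul_pos (hpos 0) (add_pos (hpos 1) (hpos 0))
    linarith
end

section
/- For N = 2, the set of real eigenvalues of B is exactly {0, −2·((α 0)⁻² + (α 1)⁻²)}; in particular the eigenvalue −2·((α 0)⁻² + (α 1)⁻²) equals 2·(min over i of B i i), so the lower eigenvalue bound 2·minᵢ B i i is attained. -/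
open Matrix

/-- For N = 2, the matrix representation of the μ-derivative ∇^μ. -/
noncomputable def matA2 (α : Fin 2 → ℝ) : Matrix (Fin 2) (Fin 2) ℝ :=
  !![-(α 0)⁻¹, (α 0)⁻¹; (α 1)⁻¹, -(α 1)⁻¹]

/-- For N = 2, the matrix representation of the μ-Laplacian Δ^μ: B = -Aᵀ·A. -/
noncomputable def matB2 (α : Fin 2 → ℝ) : Matrix (Fin 2) (Fin 2) ℝ :=
  -((matA2 α)ᵀ * matA2 α)

theorem matB2_eq (α : Fin 2 → ℝ) :
    matB2 α = !![-((α 0 ^ 2)⁻¹ + (α 1 ^ 2)⁻¹), (α 0 ^ 2)⁻¹ + (α 1 ^ 2)⁻¹;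
      (α 0 ^ 2)⁻¹ + (α 1 ^ 2)⁻¹, -((α 0 ^ 2)⁻¹ + (α 1 ^ 2)⁻¹)] := by
  ext i j
  fin_cases i <;> fin_cases j <;>
    simp [matB2, matA2, Matrix.mul_apply, Fin.sum_univ_two] <;> ring

/-- The real eigenvalues of `!![-s, s; s, -s]` are `0` and `-2 * s`. -/
theorem setOf_eigenvalue_neg_self_self_neg (s : ℝ) :
    {lam : ℝ | ∃ v : Fin 2 → ℝ, v ≠ 0 ∧ !![-s, s; s, -s].mulVec v = lam • v} =
      {0, -2 * s} := by
  ext lam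
  simp only [Set.mem_ofPred_eq, Set.mem_insert_iff, Set.mem_singleton_iff]
  constructor
  · rintro ⟨v, hv, h⟩
    have h0 := congrFun h 0
    have h1 := congrFun h 1
    simp [Matrix.mulVec, dotProduct, Fin.sum_univ_two] at h0 h1
    by_contra! hne
    obtain ⟨hlam, hlam'⟩ := hne
    have hsum : v 0 + v 1 = 0 :=
      (mul_eq_zero.mp (by linarith : lam * (v 0 + v 1) = 0)).resolve_left hlam
    have hdiff : v 0 - v 1 = 0 :=
      (mul_eq_zero.mp (by linarith : (lam - -2 * s) * (v 0 - v 1) = 0)).resolve_left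
        (sub_ne_zero.mpr hlam')
    refine hv (funext fun i => ?_)
    fin_cases i <;> simp <;> linarith
  · rintro (rfl | rfl)
    · refine ⟨![1, 1], fun h => by simpa using congrFun h 0, ?_⟩
      ext i
      fin_cases i <;> simp [Matrix.mulVec, dotProduct, Fin.sum_univ_two]
    · refine ⟨![1, -1], fun h => by simpa using congrFun h 0, ?_⟩
      ext i
      fin_cases i <;> simp [Matrix.mulVec, dotProduct, Fin.sum_univ_two] <;> ring

/-- For N = 2, the set of real eigenvalues of B is exactly
{0, −2·((α 0)⁻² + (α 1)⁻²)}, and the lower bound 2·minᵢ B i i is attained. -/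
theorem matB2_spectrum (α : Fin 2 → ℝ) (hα : ∀ i, 0 < α i) :
    {lam : ℝ | ∃ v : Fin 2 → ℝ, v ≠ 0 ∧ (matB2 α).mulVec v = lam • v} =
        {0, -2 * ((α 0 ^ 2)⁻¹ + (α 1 ^ 2)⁻¹)} ∧
      -2 * ((α 0 ^ 2)⁻¹ + (α 1 ^ 2)⁻¹) = 2 * ⨅ i, matB2 α i i := by
  rw [matB2_eq]
  refine ⟨setOf_eigenvalue_neg_self_self_neg _, ?_⟩
  have hdiag (s : ℝ) (i : Fin 2) : !![-s, s; s, -s] i i = -s := by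
    fin_cases i <;> rfl
  simp only [hdiag, ciInf_const]
  ring
end

section
/- For the uniform discrete distribution, the set of complex eigenvalues of B is exactly {−2N² + 2N²·cos(2πl/N) : l ∈ Fin N}; in particular every eigenvalue of B is real. -/
open Matrix

/-- Matrix representation of the μ-Laplacian Δ^μ for the uniform discrete probability
distribution with N atoms (αᵢ = 1/N): B i i = −2N², B i j = N² for j ≡ i±1 (mod N),
all other entries 0. -/
noncomputable def matBU (N : ℕ) [NeZero N] : Matrix (Fin N) (Fin N) ℝ :=
  Matrix.of fun i j =>
    if j = i then -2 * (N : ℝ) ^ 2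
    else if j = i + 1 ∨ j = i - 1 then (N : ℝ) ^ 2
    else 0

theorem matBU_transpose (N : ℕ) [NeZero N] : (matBU N)ᵀ = matBU N := by
  ext i j
  have h₁ : i = j + 1 ↔ j = i - 1 := by rw [eq_sub_iff_add_eq, eq_comm]
  have h₂ : i = j - 1 ↔ j = i + 1 := by rw [eq_sub_iff_add_eq, eq_comm]
  simp only [matBU, transpose_apply, of_apply, h₁, h₂, eq_comm (a := i) (b := j),
    or_comm (a := j = i - 1)]

theorem matBU_map_mulVec_apply (N : ℕ) [NeZero N] (hN : 3 ≤ N) (v : Fin N → ℂ) (i : Fin N) :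
    ((matBU N).map Complex.ofReal).mulVec v i =
      (N : ℂ) ^ 2 * (v (i + 1) + v (i - 1) - 2 * v i) := by
  obtain ⟨n, rfl⟩ : ∃ n, N = n + 3 := ⟨N - 3, by omega⟩
  have two_ne : (1 : Fin (n + 3)) + 1 ≠ 0 := by
    intro h
    have := congrArg Fin.val h
    simp [Fin.val_add, Nat.mod_eq_of_lt] at this
  have h₁ : i + 1 ≠ i := by simp
  have h₂ : i - 1 ≠ i := by simp
  have h₃ : i - 1 ≠ i + 1 := by
    intro h
    rw [sub_eq_iff_eq_add, add_assoc, left_eq_add] at h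
    exact two_ne h
  have key : ∀ j, ((matBU (n + 3)).map Complex.ofReal) i j * v j =
      (if j = i then -2 * ((n + 3 : ℕ) : ℂ) ^ 2 * v j else 0) +
      (if j = i + 1 then ((n + 3 : ℕ) : ℂ) ^ 2 * v j else 0) +
      (if j = i - 1 then ((n + 3 : ℕ) : ℂ) ^ 2 * v j else 0) := by
    intro j
    simp only [matBU, map_apply, of_apply]
    rcases eq_or_ne j i with rfl | hi
    · simp [h₁.symm, h₂.symm]
    rcases eq_or_ne j (i + 1) with rfl | hj
    · simp [h₁, h₃.symm]
    rcases eq_or_ne j (i - 1) with rfl | hk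
    · simp [h₂, h₃]
    simp [hi, hj, hk]
  simp only [mulVec, dotProduct, key, Finset.sum_add_distrib, Finset.sum_ite_eq', Finset.mem_univ,
    if_true]
  ring

theorem pow_val_add_one {M : Type*} [Monoid M] {N : ℕ} [NeZero N] {z : M} (hz : z ^ N = 1)
    (i : Fin N) : z ^ ((i + 1 : Fin N) : ℕ) = z ^ (i : ℕ) * z := by
  rw [← pow_succ, Fin.val_add, Fin.val_one', Nat.add_mod_mod, ← pow_eq_pow_mod _ hz]

theorem matBU_map_mulVec_pow (N : ℕ) [NeZero N] (hN : 3 ≤ N) {z : ℂ} (hz : z ^ N = 1) :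
    ((matBU N).map Complex.ofReal).mulVec (fun i => z ^ (i : ℕ)) =
      ((N : ℂ) ^ 2 * (z + z⁻¹ - 2)) • fun i : Fin N => z ^ (i : ℕ) := by
  have hz₀ : z ≠ 0 := by
    rintro rfl
    simp [NeZero.ne N] at hz
  ext i
  have h := pow_val_add_one hz (i - 1)
  rw [sub_add_cancel] at h
  rw [matBU_map_mulVec_apply N hN, pow_val_add_one hz, Pi.smul_apply, smul_eq_mul, h]
  field_simp

/-- For the uniform discrete distribution, the set of complex eigenvalues of B is
exactly {−2N² + 2N²·cos(2πl/N) : l ∈ Fin N}; in particular they are all real. -/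
theorem matBU_complex_spectrum (N : ℕ) [NeZero N] (hN : 3 ≤ N) :
    {lam : ℂ | ∃ v : Fin N → ℂ, v ≠ 0 ∧ ((matBU N).map Complex.ofReal).mulVec v = lam • v} =
      Set.range (fun l : Fin N =>
        (((-2 * (N : ℝ) ^ 2 + 2 * (N : ℝ) ^ 2 * Real.cos (2 * Real.pi * (l : ℕ) / N) : ℝ)) : ℂ)) := by
  have hN₀ : (N : ℂ) ≠ 0 := by exact_mod_cast NeZero.ne N
  set ω : ℂ := Complex.exp (2 * Real.pi * Complex.I / N) with hω
  have hprim : IsPrimitiveRoot ω N := Complex.isPrimitiveRoot_exp N (NeZero.ne N)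
  have hroot : ∀ l : ℕ, (ω ^ l) ^ N = 1 := fun l => by
    rw [← pow_mul, mul_comm, pow_mul, hprim.pow_eq_one, one_pow]
  have hval : ∀ l : ℕ, (N : ℂ) ^ 2 * (ω ^ l + (ω ^ l)⁻¹ - 2) =
      ((-2 * (N : ℝ) ^ 2 + 2 * (N : ℝ) ^ 2 * Real.cos (2 * Real.pi * l / N) : ℝ) : ℂ) := by
    intro l
    have h : ω ^ l = Complex.exp ((2 * Real.pi * l / N : ℂ) * Complex.I) := by
      rw [hω, ← Complex.exp_nat_mul]
      congr 1
      ring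
    push_cast
    rw [h, ← Complex.exp_neg, ← neg_mul, mul_assoc 2 (_ ^ 2), mul_left_comm 2 (_ ^ 2),
      Complex.two_cos]
    ring
  ext lam
  simp only [Set.mem_ofPred_eq, Set.mem_range, ← hval]
  constructor
  · rintro ⟨v, hv, hlam⟩
    by_contra! hne
    refine hv (eq_zero_of_mulVec_eq_zero (M := vandermonde fun l : Fin N => ω ^ (l : ℕ)) ?_ ?_)
    · rw [det_vandermonde_ne_zero_iff]
      intro a b hab
      exact Fin.ext (hprim.pow_inj a.2 b.2 hab)
    · ext l
      have h : (fun i : Fin N => (ω ^ (l : ℕ)) ^ (i : ℕ)) ⬝ᵥ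
          ((matBU N).map Complex.ofReal).mulVec v =
          ((N : ℂ) ^ 2 * (ω ^ (l : ℕ) + (ω ^ (l : ℕ))⁻¹ - 2)) *
            ((fun i : Fin N => (ω ^ (l : ℕ)) ^ (i : ℕ)) ⬝ᵥ v) := by
        rw [dotProduct_mulVec, ← mulVec_transpose, ← transpose_map, matBU_transpose,
          matBU_map_mulVec_pow N hN (hroot l), smul_dotProduct, smul_eq_mul]
      rw [hlam, dotProduct_smul, smul_eq_mul] at h
      by_contra h₀
      exact hne l (mul_right_cancel₀ h₀ h).symm
  · rintro ⟨l, rfl⟩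
    refine ⟨fun i => (ω ^ (l : ℕ)) ^ (i : ℕ), fun h => ?_, matBU_map_mulVec_pow N hN (hroot l)⟩
    simpa using congrFun h 0
end

section
/- For the uniform discrete distribution and any l ∈ Fin N, the real vector w ∈ ℝ^N with entries w j = sin(2π·j·l/N), j = 0,…,N−1, satisfies B·w = (−2N² + 2N²·cos(2πl/N))·w; for 0 < l < N/2 this vector is nonzero, hence an eigenvector of B. -/
open Matrix

theorem Fin.add_one_ne_self_of_three_le {N : ℕ} [NeZero N] (hN : 3 ≤ N) (i : Fin N) :
    i + 1 ≠ i := by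
  obtain ⟨n, rfl⟩ := Nat.exists_eq_add_of_le' hN
  intro h
  simp at h

theorem Fin.add_one_ne_sub_one_of_three_le {N : ℕ} [NeZero N] (hN : 3 ≤ N) (i : Fin N) :
    i + 1 ≠ i - 1 := by
  obtain ⟨n, rfl⟩ := Nat.exists_eq_add_of_le' hN
  intro h
  have h2 : (1 : Fin (n + 3)) + 1 = 0 := by
    have : i + (1 + 1) = i + 0 := by rw [← add_assoc, h]; simp
    exact add_left_cancel this
  have h3 := congrArg Fin.val h2
  rw [Fin.val_add] at h3
  simp [Nat.mod_eq_of_lt (show 2 < n + 3 by omega)] at h3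

theorem Fin.sub_one_ne_self_of_three_le {N : ℕ} [NeZero N] (hN : 3 ≤ N) (i : Fin N) :
    i - 1 ≠ i := by
  obtain ⟨n, rfl⟩ := Nat.exists_eq_add_of_le' hN
  intro h
  simp at h

/-- `matBU N` acts as `N²` times the second difference on the discrete circle. -/
theorem matBU_mulVec_apply {N : ℕ} [NeZero N] (hN : 3 ≤ N) (w : Fin N → ℝ) (i : Fin N) :
    (matBU N).mulVec w i = (N : ℝ) ^ 2 * (w (i + 1) + w (i - 1) - 2 * w i) := by
  have h1 := Fin.add_one_ne_self_of_three_le hN i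
  have h2 := Fin.add_one_ne_sub_one_of_three_le hN i
  have h3 := Fin.sub_one_ne_self_of_three_le hN i
  have key : ∀ j, matBU N i j * w j =
      (if j = i then -2 * (N : ℝ) ^ 2 * w j else 0) +
        ((if j = i + 1 then (N : ℝ) ^ 2 * w j else 0) +
          (if j = i - 1 then (N : ℝ) ^ 2 * w j else 0)) := by
    intro j
    simp only [matBU, Matrix.of_apply]
    split_ifs <;> grind
  simp only [Matrix.mulVec, dotProduct, key, Finset.sum_add_distrib, Finset.sum_ite_eq',
    Finset.mem_univ, if_true]
  ring

/-- The sampled sine `k ↦ sin (2πkl/N)` depends only on `k` modulo `N`. -/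
theorem Real.sin_two_pi_mul_mod (N l m : ℕ) [NeZero N] :
    Real.sin (2 * Real.pi * ((m % N : ℕ) : ℝ) * l / N) =
      Real.sin (2 * Real.pi * (m : ℝ) * l / N) := by
  have hN : (N : ℝ) ≠ 0 := NeZero.ne _
  have hm : (m : ℝ) = ((m % N : ℕ) : ℝ) + N * ((m / N : ℕ) : ℝ) := by
    exact_mod_cast (Nat.mod_add_div m N).symm
  rw [← Real.sin_add_nat_mul_two_pi _ (m / N * l)]
  congr 1
  rw [hm]
  push_cast
  field_simp

/-- For the uniform discrete distribution, the real vector with entries sin(2πjl/N)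
satisfies B·w = (−2N² + 2N²·cos(2πl/N))·w; for 0 < l < N/2 it is nonzero, hence an
eigenvector of B. -/
theorem matBU_sin_eigen (N : ℕ) [NeZero N] (hN : 3 ≤ N) (l : Fin N) :
    (matBU N).mulVec (fun j : Fin N => Real.sin (2 * Real.pi * (j : ℕ) * (l : ℕ) / N)) =
        (-2 * (N : ℝ) ^ 2 + 2 * (N : ℝ) ^ 2 * Real.cos (2 * Real.pi * (l : ℕ) / N)) •
          (fun j : Fin N => Real.sin (2 * Real.pi * (j : ℕ) * (l : ℕ) / N)) ∧
      (0 < (l : ℕ) ∧ 2 * (l : ℕ) < N →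
        (fun j : Fin N => Real.sin (2 * Real.pi * (j : ℕ) * (l : ℕ) / N)) ≠ 0) := by
  have hN0 : (0 : ℝ) < N := by exact_mod_cast (by omega : 0 < N)
  have hone : ((1 : Fin N) : ℕ) = 1 := by
    rw [Fin.val_one', Nat.mod_eq_of_lt (by omega)]
  constructor
  · funext i
    rw [matBU_mulVec_apply hN]
    simp only [Pi.smul_apply, smul_eq_mul]
    have hplus : Real.sin (2 * Real.pi * ((i + 1 : Fin N) : ℕ) * (l : ℕ) / N) =
        Real.sin (2 * Real.pi * (i : ℕ) * (l : ℕ) / N + 2 * Real.pi * (l : ℕ) / N) := by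
      rw [Fin.val_add, Real.sin_two_pi_mul_mod, hone]
      congr 1
      push_cast
      ring
    have hminus : Real.sin (2 * Real.pi * ((i - 1 : Fin N) : ℕ) * (l : ℕ) / N) =
        Real.sin (2 * Real.pi * (i : ℕ) * (l : ℕ) / N - 2 * Real.pi * (l : ℕ) / N) := by
      rw [Fin.val_sub, Real.sin_two_pi_mul_mod, hone, ← Real.sin_add_nat_mul_two_pi (_ - _) l]
      congr 1
      rw [Nat.cast_add, Nat.cast_sub (by omega)]
      push_cast
      field_simp
      ring
    rw [hplus, hminus, Real.sin_add, Real.sin_sub]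
    ring
  · rintro ⟨hl, hlN⟩ h
    have h1 := congrFun h 1
    simp only [hone, Nat.cast_one, mul_one, Pi.zero_apply] at h1
    have hl' : (0 : ℝ) < (l : ℕ) := by exact_mod_cast hl
    have hlN' : 2 * ((l : ℕ) : ℝ) < N := by exact_mod_cast hlN
    refine (Real.sin_pos_of_pos_of_lt_pi (by positivity) ?_).ne' h1
    rw [div_lt_iff₀ hN0]
    nlinarith [Real.pi_pos]
end

section
/- For the alternating six-atom distribution, the vector (1, −1, 1, −1, 1, −1)ᵀ is an eigenvector of B with eigenvalue −2·(m₁⁻² + m₂⁻²): B·(1,−1,1,−1,1,−1)ᵀ = −2·(m₁⁻² + m₂⁻²)·(1,−1,1,−1,1,−1)ᵀ. -/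
open Matrix

/-- Alternating weights for the six-atom distribution: α i = m₁ for i ∈ {0,2,4} and
α i = m₂ for i ∈ {1,3,5}. -/
noncomputable def alt6 (m₁ m₂ : ℝ) : Fin 6 → ℝ :=
  fun i => if (i : ℕ) % 2 = 0 then m₁ else m₂

/-- Matrix representation of the μ-derivative for the alternating six-atom
distribution: A i i = −(α i)⁻¹, A i (i+1 mod 6) = (α i)⁻¹, all other entries 0. -/
noncomputable def matA6 (m₁ m₂ : ℝ) : Matrix (Fin 6) (Fin 6) ℝ :=
  Matrix.of fun i j =>
    if j = i then -(alt6 m₁ m₂ i)⁻¹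
    else if j = i + 1 then (alt6 m₁ m₂ i)⁻¹
    else 0

/-- Matrix representation of the μ-Laplacian Δ^μ: B = −Aᵀ·A. -/
noncomputable def matB6 (m₁ m₂ : ℝ) : Matrix (Fin 6) (Fin 6) ℝ :=
  -((matA6 m₁ m₂)ᵀ * matA6 m₁ m₂)

theorem matA6_eq (m₁ m₂ : ℝ) :
    matA6 m₁ m₂ =
      !![-m₁⁻¹, m₁⁻¹, 0, 0, 0, 0;
         0, -m₂⁻¹, m₂⁻¹, 0, 0, 0;
         0, 0, -m₁⁻¹, m₁⁻¹, 0, 0;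
         0, 0, 0, -m₂⁻¹, m₂⁻¹, 0;
         0, 0, 0, 0, -m₁⁻¹, m₁⁻¹;
         m₂⁻¹, 0, 0, 0, 0, -m₂⁻¹] := by
  ext i j
  fin_cases i <;> fin_cases j <;> simp [matA6, alt6]

/-- For the alternating six-atom distribution, (1,−1,1,−1,1,−1)ᵀ is an eigenvector
of B with eigenvalue −2·(m₁⁻² + m₂⁻²). -/
theorem matB6_alternating_eigen (m₁ m₂ : ℝ) (hm₁ : 0 < m₁) (hm₂ : 0 < m₂) :
    (matB6 m₁ m₂).mulVec ![1, -1, 1, -1, 1, -1] =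
      (-2 * ((m₁ ^ 2)⁻¹ + (m₂ ^ 2)⁻¹)) • ![1, -1, 1, -1, 1, -1] := by
  rw [matB6, neg_mulVec, ← mulVec_mulVec, matA6_eq]
  ext i
  fin_cases i <;> simp [mulVec, dotProduct, Fin.sum_univ_six] <;> ring
end

section
/- For the alternating six-atom distribution, set r = m₂/m₁ and s = √(1 + r⁴ − r²). Then the vector v⁽¹⁾ = (r², s, 1 − r², −s, −1, 0)ᵀ is nonzero and satisfies B·v⁽¹⁾ = λ₁·v⁽¹⁾, where λ₁ = −(m₁⁻² + m₂⁻²) + √(m₁⁻⁴ + m₂⁻⁴ − m₁⁻²·m₂⁻²); hence λ₁ is an eigenvalue of B. -/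
open Matrix

/-- The alternating six-atom Laplacian acts as a weighted second difference on the cycle. -/
theorem matB6_mulVec (m₁ m₂ : ℝ) (v : Fin 6 → ℝ) :
    (matB6 m₁ m₂).mulVec v =
      ![(m₁ ^ 2)⁻¹ * (v 1 - v 0) + (m₂ ^ 2)⁻¹ * (v 5 - v 0),
        (m₂ ^ 2)⁻¹ * (v 2 - v 1) + (m₁ ^ 2)⁻¹ * (v 0 - v 1),
        (m₁ ^ 2)⁻¹ * (v 3 - v 2) + (m₂ ^ 2)⁻¹ * (v 1 - v 2),
        (m₂ ^ 2)⁻¹ * (v 4 - v 3) + (m₁ ^ 2)⁻¹ * (v 2 - v 3),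
        (m₁ ^ 2)⁻¹ * (v 5 - v 4) + (m₂ ^ 2)⁻¹ * (v 3 - v 4),
        (m₂ ^ 2)⁻¹ * (v 0 - v 5) + (m₁ ^ 2)⁻¹ * (v 4 - v 5)] := by
  rw [matB6, neg_mulVec, ← mulVec_mulVec]
  ext i
  fin_cases i <;>
    simp [-mulVec_mulVec, mulVec, dotProduct, Fin.sum_univ_six, matA6, alt6, Fin.ext_iff,
      Fin.val_add] <;>
    ring

/-- For the alternating six-atom distribution, with r = m₂/m₁ and s = √(1 + r⁴ − r²),
the vector v⁽¹⁾ = (r², s, 1 − r², −s, −1, 0)ᵀ is nonzero and satisfies B·v⁽¹⁾ = λ₁·v⁽¹⁾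
with λ₁ = −(m₁⁻² + m₂⁻²) + √(m₁⁻⁴ + m₂⁻⁴ − m₁⁻²·m₂⁻²); hence λ₁ is an eigenvalue of B. -/
theorem matB6_eigen_v1 (m₁ m₂ : ℝ) (hm₁ : 0 < m₁) (hm₂ : 0 < m₂) :
    let r : ℝ := m₂ / m₁
    let s : ℝ := Real.sqrt (1 + r ^ 4 - r ^ 2)
    let v : Fin 6 → ℝ := ![r ^ 2, s, 1 - r ^ 2, -s, -1, 0]
    v ≠ 0 ∧
      (matB6 m₁ m₂).mulVec v =
        (-((m₁ ^ 2)⁻¹ + (m₂ ^ 2)⁻¹) +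
          Real.sqrt ((m₁ ^ 4)⁻¹ + (m₂ ^ 4)⁻¹ - (m₁ ^ 2)⁻¹ * (m₂ ^ 2)⁻¹)) • v := by
  intro r s v
  have hs : s ^ 2 = 1 + r ^ 4 - r ^ 2 :=
    Real.sq_sqrt (by nlinarith [sq_nonneg (r ^ 2 - 1), sq_nonneg r])
  have hS : Real.sqrt ((m₁ ^ 4)⁻¹ + (m₂ ^ 4)⁻¹ - (m₁ ^ 2)⁻¹ * (m₂ ^ 2)⁻¹) =
      s * (m₂ ^ 2)⁻¹ := by
    rw [← Real.sqrt_sq (show 0 ≤ s * (m₂ ^ 2)⁻¹ by positivity), mul_pow, hs]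
    congr 1
    simp only [r]
    field_simp
    ring
  have hr : (m₁ ^ 2)⁻¹ = r ^ 2 * (m₂ ^ 2)⁻¹ := by
    simp only [r]
    field_simp
  refine ⟨fun h => by simpa [v] using congrFun h 4, ?_⟩
  rw [hS, matB6_mulVec, hr]
  ext i
  fin_cases i <;> simp [v]
  all_goals grind
end

section
/- For the alternating six-atom distribution, set r = m₂/m₁ and s = √(1 + r⁴ − r²), and let v⁽¹⁾ = (r², s, 1 − r², −s, −1, 0)ᵀ and v⁽⁵⁾ = (s, r² − 1, −s, −r², 0, 1)ᵀ. Then for every index i ∈ Fin 6, the point (x, y) = (v⁽¹⁾ i, v⁽⁵⁾ i) lies on the ellipse √(1 + r⁻⁴ − r⁻²)·(x² + y² − 1) = (2 − r⁻²)·x·y. -/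
open Matrix

/-- The entrywise pairs of the two eigenvectors v⁽¹⁾, v⁽⁵⁾ for the double eigenvalue
λ₁ = λ₅ all lie on the ellipse √(1 + r⁻⁴ − r⁻²)·(x² + y² − 1) = (2 − r⁻²)·x·y. -/
theorem matB6_eigenvector_ellipse (m₁ m₂ : ℝ) (hm₁ : 0 < m₁) (hm₂ : 0 < m₂) :
    let r : ℝ := m₂ / m₁
    let s : ℝ := Real.sqrt (1 + r ^ 4 - r ^ 2)
    let v₁ : Fin 6 → ℝ := ![r ^ 2, s, 1 - r ^ 2, -s, -1, 0]
    let v₅ : Fin 6 → ℝ := ![s, r ^ 2 - 1, -s, -(r ^ 2), 0, 1]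
    ∀ i : Fin 6,
      Real.sqrt (1 + (r ^ 4)⁻¹ - (r ^ 2)⁻¹) * ((v₁ i) ^ 2 + (v₅ i) ^ 2 - 1) =
        (2 - (r ^ 2)⁻¹) * (v₁ i * v₅ i) := by
  intro r s v₁ v₅
  have hr : 0 < r := div_pos hm₂ hm₁
  have hs : s ^ 2 = 1 + r ^ 4 - r ^ 2 :=
    Real.sq_sqrt (by nlinarith [sq_nonneg (r ^ 2 - 1), sq_nonneg r])
  have hs_nonneg : 0 ≤ s := Real.sqrt_nonneg _
  clear_value s r
  have hsqrt : Real.sqrt (1 + (r ^ 4)⁻¹ - (r ^ 2)⁻¹) = s / r ^ 2 := by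
    rw [show 1 + (r ^ 4)⁻¹ - (r ^ 2)⁻¹ = (s / r ^ 2) ^ 2 by
      rw [div_pow, hs]
      field_simp
      ring]
    exact Real.sqrt_sq (div_nonneg hs_nonneg (sq_nonneg r))
  rw [hsqrt]
  intro i
  fin_cases i <;> simp [v₁, v₅] <;> field_simp <;> rw [hs] <;> ring
end
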